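/- Let U ⊂ ℝ^{1+3} be open, let r, π : U → ℝ be differentiable and strictly positive, let u : U → ℝ^4 be differentiable, and let λ, ζ : ℝ → ℝ be differentiable. If equations (i) and (iii) of the Israel–Stewart system hold on U, then pointwise on U: D_t(r/π) = (r/π) + λ(r^{1/κ}) r^{2+1/κ} (π/r)^{1+1/κ} - κ (r+1) (r/π) ∂_μ u^μ - κ r^2 (π/r)^{1+1/κ} ∂_μ u^μ + ( ζ(r^{1/κ}) r / π^{3+1/κ} ) ∂_μ u^μ. -/

import Mathlib

open Set

/-- Partial derivative `∂_μ` on `ℝ^{1+3}`. -/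
noncomputable def pd (μ : Fin 4) (f : (Fin 4 → ℝ) → ℝ) : (Fin 4 → ℝ) → ℝ :=
  fun x => fderiv ℝ f x (Pi.single μ 1)

/-- The divergence `∂_μ u^μ` of a vector field on `ℝ^{1+3}`. -/
noncomputable def divu (u : (Fin 4 → ℝ) → Fin 4 → ℝ) (x : Fin 4 → ℝ) : ℝ :=
  ∑ μ, pd μ (fun y => u y μ) x

/-- The material derivative `D_t f = u^μ ∂_μ f`. -/
noncomputable def Dt (u : (Fin 4 → ℝ) → Fin 4 → ℝ) (f : (Fin 4 → ℝ) → ℝ)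
    (x : Fin 4 → ℝ) : ℝ :=
  ∑ μ, u x μ * pd μ f x

/-- Equation (i) of the Israel–Stewart system in the variables `(r,u,π)`:
`u^μ ∂_μ r + κ r a_1 ∂_μ u^μ = 0`, with `a_1 = r + 1 + r^2 (π/r)^{2+1/κ}`. -/
def EqI (κ : ℝ) (r : (Fin 4 → ℝ) → ℝ) (u : (Fin 4 → ℝ) → Fin 4 → ℝ)
    (pbar : (Fin 4 → ℝ) → ℝ) (x : Fin 4 → ℝ) : Prop :=
  Dt u r x + κ * r x * (r x + 1 + (r x) ^ 2 * (pbar x / r x) ^ ((2:ℝ) + 1/κ)) * divu u x = 0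

/-- Equation (iii) of the Israel–Stewart system:
`u^μ ∂_μ π + π + λ(r^{1/κ}) π^{3+1/κ} + r a_4 ∂_μ u^μ = 0`,
with `a_4 = ζ(r^{1/κ})/(r π^{1+1/κ})`. -/
def EqIII (κ : ℝ) (lam zeta : ℝ → ℝ) (r : (Fin 4 → ℝ) → ℝ)
    (u : (Fin 4 → ℝ) → Fin 4 → ℝ) (pbar : (Fin 4 → ℝ) → ℝ) (x : Fin 4 → ℝ) : Prop :=
  Dt u pbar x + pbar x + lam (r x ^ (1/κ)) * pbar x ^ ((3:ℝ) + 1/κ)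
    + r x * (zeta (r x ^ (1/κ)) / (r x * pbar x ^ ((1:ℝ) + 1/κ))) * divu u x = 0

/-- Quotient rule for the material derivative. -/
theorem Dt_div {u : (Fin 4 → ℝ) → Fin 4 → ℝ} {f g : (Fin 4 → ℝ) → ℝ} {x : Fin 4 → ℝ}
    (hf : DifferentiableAt ℝ f x) (hg : DifferentiableAt ℝ g x) (hx : g x ≠ 0) :
    Dt u (fun y => f y / g y) x = Dt u f x / g x - f x * Dt u g x / g x ^ 2 := by
  have hpd (μ : Fin 4) : pd μ (fun y => f y / g y) x
      = pd μ f x / g x - f x * pd μ g x / g x ^ 2 := by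
    have h := hf.hasFDerivAt.mul ((hasDerivAt_inv hx).comp_hasFDerivAt x hg.hasFDerivAt)
    have h' : HasFDerivAt (fun y => f y / g y) _ x := h
    simp only [pd, h'.fderiv]
    simp
    field_simp
    ring
  simp only [Dt, hpd, Finset.mul_sum, Finset.sum_div, ← Finset.sum_sub_distrib]
  refine Finset.sum_congr rfl fun μ _ => ?_
  ring

/-- **Evolution of `1/a_0 = r/π`** (second identity of (2.11) in the paper): along solutions
of equations (i) and (iii) of the Israel–Stewart system,
`D_t(r/π) = (r/π) + λ(r^{1/κ}) r^{2+1/κ} (π/r)^{1+1/κ} - κ(r+1)(r/π) ∂_μ u^μ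
  - κ r² (π/r)^{1+1/κ} ∂_μ u^μ + (ζ(r^{1/κ}) r/π^{3+1/κ}) ∂_μ u^μ`. -/
theorem evolution_inv_a0 (κ : ℝ) (hκ : 0 < κ) (lam zeta : ℝ → ℝ)
    (hlam : Differentiable ℝ lam) (hzeta : Differentiable ℝ zeta)
    (U : Set (Fin 4 → ℝ)) (hU : IsOpen U)
    (r pbar : (Fin 4 → ℝ) → ℝ) (u : (Fin 4 → ℝ) → Fin 4 → ℝ)
    (hr : DifferentiableOn ℝ r U) (hpbar : DifferentiableOn ℝ pbar U)
    (hu : ∀ μ, DifferentiableOn ℝ (fun x => u x μ) U)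
    (hrpos : ∀ x ∈ U, 0 < r x) (hppos : ∀ x ∈ U, 0 < pbar x)
    (heqI : ∀ x ∈ U, EqI κ r u pbar x)
    (heqIII : ∀ x ∈ U, EqIII κ lam zeta r u pbar x) :
    ∀ x ∈ U,
      Dt u (fun y => r y / pbar y) x
        = r x / pbar x
          + lam (r x ^ (1/κ)) * r x ^ ((2:ℝ) + 1/κ) * (pbar x / r x) ^ ((1:ℝ) + 1/κ)
          - κ * (r x + 1) * (r x / pbar x) * divu u x
          - κ * (r x) ^ 2 * (pbar x / r x) ^ ((1:ℝ) + 1/κ) * divu u x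
          + (zeta (r x ^ (1/κ)) * r x / pbar x ^ ((3:ℝ) + 1/κ)) * divu u x := by
  intro x hx
  have hR := hrpos x hx
  have hP := hppos x hx
  have h1 := heqI x hx
  have h3 := heqIII x hx
  have hxU := hU.mem_nhds hx
  rw [Dt_div (hr.differentiableAt hxU) (hpbar.differentiableAt hxU) hP.ne']
  unfold EqI at h1
  unfold EqIII at h3
  have split_two {a : ℝ} (ha : 0 < a) : a ^ ((2:ℝ) + 1/κ) = a * a ^ ((1:ℝ) + 1/κ) := by
    rw [← Real.rpow_one_add' ha.le (by positivity)]
    ring_nf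
  have split_three {a : ℝ} (ha : 0 < a) : a ^ ((3:ℝ) + 1/κ) = a ^ 2 * a ^ ((1:ℝ) + 1/κ) := by
    rw [← Real.rpow_natCast a 2, ← Real.rpow_add ha]
    congr 1
    push_cast
    ring
  rw [split_two (div_pos hP hR), Real.div_rpow hP.le hR.le] at h1
  rw [split_three hP] at h3
  rw [split_two hR, split_three hP, Real.div_rpow hP.le hR.le]
  have hRp := Real.rpow_pos_of_pos hR ((1:ℝ) + 1/κ)
  have hPp := Real.rpow_pos_of_pos hP ((1:ℝ) + 1/κ)
  generalize r x ^ ((1:ℝ) + 1/κ) = A at *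
  generalize pbar x ^ ((1:ℝ) + 1/κ) = B at *
  rw [eq_sub_of_add_eq h1 |>.trans (zero_sub _),
    show Dt u pbar x = -(pbar x + lam (r x ^ (1/κ)) * (pbar x ^ 2 * B)
      + r x * (zeta (r x ^ (1/κ)) / (r x * B)) * divu u x) by linarith]
  generalize lam (r x ^ (1/κ)) = L
  generalize zeta (r x ^ (1/κ)) = Z
  field_simp
  ring
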